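/- Assume W*V = I_S, f_s is continuous, and there is L ≥ 0 with ‖f_s(t,a) − f_s(t,b)‖ ≤ L‖a − b‖ for all t ∈ ℝ and a, b ∈ ℂ^S. Let Y ∈ ℂ^N and suppose: (i) v : [0,H] → ℂ^N satisfies v(0) = Y and, for every θ ∈ [0,H], v'(θ) = δ V f_s(T + δθ, W* v(θ)) + Σ_{j=1}^{i} γ_j(θ/H) g_j with g_j := f(T_j, Y_j) − V f_s(T_j, W* Y_j); and (ii) z : [0,H] → ℂ^S satisfies z(0) = W* Y and, for every θ ∈ [0,H], z'(θ) = δ f_s(T + δθ, z(θ)) + Σ_{j=1}^{i} γ_j(θ/H) ( W* f(T_j, Y_j) − f_s(T_j, W* Y_j) ). Then v(H) = V z(H) + (I_N − V W*) ( Y + H Σ_{j=1}^{i} γ̄_j f(T_j, Y_j) ), where γ̄_j := ∫₀¹ γ_j(τ) dτ. In other words, the SM-MRI-GARK stage update of Definition 3.1, which solves only an S-dimensional ODE, coincides with the exact endpoint of the N-dimensional MRI-GARK modified fast ODE applied to the partitioned system y' = V f_s(t, W*y) + ( f(t,y) − V f_s(t, W*y) ). -/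

import Mathlib

open Matrix

/-- If `W* V = I_S`, `f_s` is continuous and `L`-Lipschitz in its second
argument, `v` solves the N-dimensional modified fast ODE with `v(0) = Y`, and `z`
solves the S-dimensional modified fast ODE with `z(0) = W* Y`, then
`v(H) = V z(H) + (I − V W*) (Y + H Σ_j γ̄_j f(T_j, Y_j))` with
`γ̄_j = ∫₀¹ γ_j(τ) dτ`: the SM-MRI-GARK stage update coincides with the exact endpoint
of the N-dimensional MRI-GARK modified fast ODE for the partitioned system. -/
theorem sm_mri_gark_stage_equivalence (N S : ℕ) (hN : 0 < N) (hS : 0 < S)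
    (V W : Matrix (Fin N) (Fin S) ℂ) (hVW : Wᴴ * V = 1)
    (f : ℝ → (Fin N → ℂ) → (Fin N → ℂ))
    (fs : ℝ → (Fin S → ℂ) → (Fin S → ℂ))
    (hfs : Continuous fun p : ℝ × (Fin S → ℂ) => fs p.1 p.2)
    (L : ℝ) (hL : 0 ≤ L)
    (hlip : ∀ (t : ℝ) (a b : Fin S → ℂ), ‖fs t a - fs t b‖ ≤ L * ‖a - b‖)
    (H : ℝ) (hH : 0 < H) (δ T : ℝ) (i : ℕ)
    (Tj : Fin i → ℝ) (Y : Fin i → (Fin N → ℂ)) (γ : Fin i → Polynomial ℝ)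
    (g : Fin i → (Fin N → ℂ))
    (hg : ∀ j, g j = f (Tj j) (Y j) - V.mulVec (fs (Tj j) (Wᴴ.mulVec (Y j))))
    (Y0 : Fin N → ℂ)
    (v : ℝ → (Fin N → ℂ)) (hv0 : v 0 = Y0)
    (hv : ∀ θ ∈ Set.Icc (0:ℝ) H,
      HasDerivAt v
        (δ • V.mulVec (fs (T + δ * θ) (Wᴴ.mulVec (v θ))) +
          ∑ j, ((γ j).eval (θ / H)) • g j) θ)
    (z : ℝ → (Fin S → ℂ)) (hz0 : z 0 = Wᴴ.mulVec Y0)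
    (hz : ∀ θ ∈ Set.Icc (0:ℝ) H,
      HasDerivAt z
        (δ • fs (T + δ * θ) (z θ) +
          ∑ j, ((γ j).eval (θ / H)) •
            (Wᴴ.mulVec (f (Tj j) (Y j)) - fs (Tj j) (Wᴴ.mulVec (Y j)))) θ) :
    v H =
      V.mulVec (z H) +
        ((Y0 + H • ∑ j, (∫ τ in (0:ℝ)..1, (γ j).eval τ) • f (Tj j) (Y j)) -
          (V * Wᴴ).mulVec
            (Y0 + H • ∑ j, (∫ τ in (0:ℝ)..1, (γ j).eval τ) • f (Tj j) (Y j))) := by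
  have key : ∀ (m n : ℕ) (A : Matrix (Fin m) (Fin n) ℂ) (u : ℝ → (Fin n → ℂ)) (u' : Fin n → ℂ)
      (t : ℝ), HasDerivAt u u' t → HasDerivAt (fun s => A.mulVec (u s)) (A.mulVec u') t := by
    intro m n A u u' t h
    have h1 := ((LinearMap.toContinuousLinearMap
      (A.mulVecLin.restrictScalars ℝ)).hasFDerivAt (x := u t)).comp_hasDerivAt t h
    exact h1
  have hWV : ∀ x : Fin S → ℂ, Wᴴ.mulVec (V.mulVec x) = x := by
    intro x
    rw [Matrix.mulVec_mulVec, hVW, Matrix.one_mulVec]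
  have hsm : ∀ (m n : ℕ) (A : Matrix (Fin m) (Fin n) ℂ) (c : ℝ) (x : Fin n → ℂ),
      A.mulVec (c • x) = c • A.mulVec x := fun m n A c x => Matrix.mulVec_smul A c x
  have hsum : ∀ (m n : ℕ) (A : Matrix (Fin m) (Fin n) ℂ) (x : Fin i → (Fin n → ℂ)),
      A.mulVec (∑ j, x j) = ∑ j, A.mulVec (x j) := by
    intro m n A x
    exact map_sum A.mulVecLin x Finset.univ
  -- the projected full solution solves the reduced problem
  have hu : ∀ θ ∈ Set.Icc (0:ℝ) H, HasDerivAt (fun s => Wᴴ.mulVec (v s))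
        (δ • fs (T + δ * θ) (Wᴴ.mulVec (v θ)) +
          ∑ j, ((γ j).eval (θ / H)) •
            (Wᴴ.mulVec (f (Tj j) (Y j)) - fs (Tj j) (Wᴴ.mulVec (Y j)))) θ := by
    intro θ hθ
    have h := key _ _ Wᴴ v _ θ (hv θ hθ)
    simpa only [Matrix.mulVec_add, hsum, hsm, hWV, hg, Matrix.mulVec_sub] using h
  have huz : Set.EqOn (fun s => Wᴴ.mulVec (v s)) z (Set.Icc 0 H) := by
    refine ODE_solution_unique_of_mem_Icc_right
      (v := fun t a => δ • fs (T + δ * t) a + ∑ j, ((γ j).eval (t / H)) •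
            (Wᴴ.mulVec (f (Tj j) (Y j)) - fs (Tj j) (Wᴴ.mulVec (Y j))))
      (s := fun _ => Set.univ) (K := Real.toNNReal (|δ| * L)) ?_ ?_ ?_ ?_ ?_ ?_ ?_ ?_
    · intro t _
      refine LipschitzWith.lipschitzOnWith (LipschitzWith.of_dist_le_mul ?_)
      intro a b
      rw [dist_add_right, dist_eq_norm, dist_eq_norm, ← smul_sub, norm_smul,
        Real.coe_toNNReal _ (by positivity), Real.norm_eq_abs, mul_assoc]
      exact mul_le_mul_of_nonneg_left (hlip _ _ _) (abs_nonneg _)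
    · exact fun t ht => (hu t ht).continuousAt.continuousWithinAt
    · exact fun t ht => (hu t ⟨ht.1, ht.2.le⟩).hasDerivWithinAt
    · exact fun _ _ => Set.mem_univ _
    · exact fun t ht => (hz t ht).continuousAt.continuousWithinAt
    · exact fun t ht => (hz t ⟨ht.1, ht.2.le⟩).hasDerivWithinAt
    · exact fun _ _ => Set.mem_univ _
    · simp only [hv0, hz0]
  have hw : ∀ θ ∈ Set.uIcc (0:ℝ) H, HasDerivAt (fun s => v s - V.mulVec (z s))
      (∑ j, ((γ j).eval (θ / H)) •
        (f (Tj j) (Y j) - V.mulVec (Wᴴ.mulVec (f (Tj j) (Y j))))) θ := by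
    intro θ hθ
    rw [Set.uIcc_of_le hH.le] at hθ
    have h := (hv θ hθ).sub (key _ _ V z _ θ (hz θ hθ))
    have e : Wᴴ.mulVec (v θ) = z θ := huz hθ
    refine HasDerivAt.congr_deriv h (Eq.symm ?_)
    rw [e]
    simp only [Matrix.mulVec_add, hsum, hsm, hg, Matrix.mulVec_sub]
    rw [add_sub_add_left_eq_sub, ← Finset.sum_sub_distrib]
    refine Finset.sum_congr rfl fun j _ => ?_
    rw [← smul_sub]
    congr 1
    abel
  have hcont : ∀ j, Continuous fun θ : ℝ => (γ j).eval (θ / H) := fun j =>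
    (γ j).continuous.comp (continuous_id.div_const H)
  have hci : ∀ j, IntervalIntegrable (fun θ : ℝ => ((γ j).eval (θ / H)) •
      (f (Tj j) (Y j) - V.mulVec (Wᴴ.mulVec (f (Tj j) (Y j))))) MeasureTheory.volume 0 H :=
    fun j => ((hcont j).smul continuous_const).intervalIntegrable _ _
  have hint := intervalIntegral.integral_eq_sub_of_hasDerivAt hw
    (Continuous.intervalIntegrable
      (continuous_finsetSum _ fun j _ => (hcont j).smul continuous_const) _ _)
  rw [intervalIntegral.integral_finsetSum
    (fun j _ => hci j)] at hint
  simp only [intervalIntegral.integral_smul_const] at hint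
  have hI : ∀ j, (∫ θ in (0:ℝ)..H, (γ j).eval (θ / H)) = H * ∫ τ in (0:ℝ)..1, (γ j).eval τ := by
    intro j
    rw [intervalIntegral.integral_comp_div (fun x => (γ j).eval x) hH.ne', zero_div,
      div_self hH.ne', smul_eq_mul]
  simp only [hI, hv0, hz0] at hint
  rw [← Matrix.mulVec_mulVec]
  simp only [Matrix.mulVec_add, hsum, hsm]
  simp only [smul_sub, Finset.sum_sub_distrib, mul_smul, ← Finset.smul_sum] at hint
  have h2 := sub_eq_iff_eq_add.mp (sub_eq_iff_eq_add.mp hint.symm)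
  rw [h2]
  abel
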